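/- Define A(m) := ∑_{i=1}^{m-1} 2^{m-1-i}·(2^{-(2^i - 2)} - 2^{-(2^{i+1} - 2)}) + 2^{m-1} - (2^m - 1)·η for integers m ≥ 1. Then for every integer m ≥ 2, (2^{-(2^{m-1} - 2)} - 2^{-(2^m - 2)}) - 2·(A(m) - A(m-1)) ≥ 0. (This is the inequality ΔP - Δα ≥ 0 ensuring that the dual variable β can be set nonnegatively in Case 1 of the primal–dual analysis.) -/

import Mathlib

open Finset

/-- `η := 1 - ∑_{i=1}^∞ 2^{-(2^i + i - 1)}` (reindexed by `i ↦ i + 1`, noting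
`2^(i+1) + (i+1) - 1 = 2^(i+1) + i`). -/
noncomputable def eta : ℝ := 1 - ∑' i : ℕ, (1 / 2 : ℝ) ^ (2 ^ (i + 1) + i)

/-- `A m = α_{(2^m - 1)}`: the closed form
`∑_{i=1}^{m-1} 2^{m-1-i}·(2^{-(2^i-2)} - 2^{-(2^{i+1}-2)}) + 2^{m-1} - (2^m - 1)·η`
(note `2·(2^i - 2) + 2 = 2^{i+1} - 2`). -/
noncomputable def A (m : ℕ) : ℝ :=
  (∑ i ∈ Finset.Icc 1 (m - 1),
      (2 : ℝ) ^ (m - 1 - i) *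
        ((1 / 2 : ℝ) ^ (2 ^ i - 2) - (1 / 2 : ℝ) ^ (2 ^ (i + 1) - 2)))
    + 2 ^ (m - 1) - ((2 : ℝ) ^ m - 1) * eta

lemma half_pow_two_pow_sub_two {i : ℕ} (hi : 1 ≤ i) :
    (1 / 2 : ℝ) ^ (2 ^ i - 2) = 4 * (1 / 2 : ℝ) ^ 2 ^ i := by
  have h : 2 ≤ 2 ^ i := by simpa using Nat.pow_le_pow_right (n := 2) (by norm_num) hi
  obtain ⟨k, hk⟩ := Nat.exists_eq_add_of_le h
  rw [hk, Nat.add_sub_cancel_left, pow_add]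
  ring

lemma eta_term_le (m i : ℕ) :
    (1 / 2 : ℝ) ^ (2 ^ (i + m + 1) + (i + m)) ≤
      (1 / 2 : ℝ) ^ (2 ^ (m + 1) + m) * (1 / 2) ^ i := by
  rw [← pow_add]
  refine pow_le_pow_of_le_one (by norm_num) (by norm_num) ?_
  have h : 2 ^ (m + 1) ≤ 2 ^ (i + m + 1) := Nat.pow_le_pow_right (by norm_num) (by omega)
  omega

lemma summable_eta_term : Summable fun i : ℕ => (1 / 2 : ℝ) ^ (2 ^ (i + 1) + i) :=
  Summable.of_nonneg_of_le (fun _ => by positivity) (fun i => eta_term_le 0 i)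
    (summable_geometric_two.mul_left _)

lemma one_sub_eta_sub_sum_le (m : ℕ) :
    1 - eta - ∑ i ∈ range m, (1 / 2 : ℝ) ^ (2 ^ (i + 1) + i) ≤
      2 * (1 / 2 : ℝ) ^ (2 ^ (m + 1) + m) := by
  have h₁ := summable_eta_term.sum_add_tsum_nat_add m
  have h₂ := ((summable_nat_add_iff m).2 summable_eta_term).tsum_le_tsum (eta_term_le m)
    (summable_geometric_two.mul_left _)
  rw [tsum_mul_left, tsum_geometric_two] at h₂
  unfold eta
  linarith

lemma sum_Icc_two_pow_mul_sub (n : ℕ) :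
    ∑ i ∈ Icc 1 n, (2 : ℝ) ^ (n - i) *
        ((1 / 2 : ℝ) ^ (2 ^ i - 2) - (1 / 2 : ℝ) ^ (2 ^ (i + 1) - 2)) =
      2 ^ n - 2 ^ (n + 1) * ∑ i ∈ range (n + 1), (1 / 2 : ℝ) ^ (2 ^ (i + 1) + i)
        - 2 * (1 / 2 : ℝ) ^ 2 ^ (n + 1) := by
  induction n with
  | zero => norm_num
  | succ n ih =>
    have h : ∑ i ∈ Icc 1 n, (2 : ℝ) ^ (n + 1 - i) *
        ((1 / 2 : ℝ) ^ (2 ^ i - 2) - (1 / 2 : ℝ) ^ (2 ^ (i + 1) - 2)) =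
        2 * ∑ i ∈ Icc 1 n, (2 : ℝ) ^ (n - i) *
        ((1 / 2 : ℝ) ^ (2 ^ i - 2) - (1 / 2 : ℝ) ^ (2 ^ (i + 1) - 2)) := by
      rw [mul_sum]
      refine sum_congr rfl fun i hi => ?_
      rw [Nat.succ_sub (mem_Icc.1 hi).2, pow_succ]
      ring
    have hp : (2 : ℝ) ^ n * (1 / 2) ^ n = 1 := by rw [← mul_pow]; norm_num
    rw [sum_Icc_succ_top (by omega), h, ih, sum_range_succ _ (n + 1),
      half_pow_two_pow_sub_two (by omega), half_pow_two_pow_sub_two (by omega), Nat.sub_self,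
      pow_add _ (2 ^ (n + 1 + 1)) (n + 1)]
    generalize (1 / 2 : ℝ) ^ 2 ^ (n + 1 + 1) = y
    generalize (1 / 2 : ℝ) ^ 2 ^ (n + 1) = x
    generalize ∑ i ∈ range (n + 1), (1 / 2 : ℝ) ^ (2 ^ (i + 1) + i) = s
    simp only [pow_succ]
    linear_combination 2 * y * hp

lemma A_succ (n : ℕ) :
    A (n + 1) =
      2 ^ (n + 1) * (1 - eta - ∑ i ∈ range (n + 1), (1 / 2 : ℝ) ^ (2 ^ (i + 1) + i))
        - 2 * (1 / 2 : ℝ) ^ 2 ^ (n + 1) + eta := by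
  rw [A, Nat.add_sub_cancel, sum_Icc_two_pow_mul_sub]
  ring

/-- `ΔP - Δα ≥ 0` in Case 1 of the primal–dual analysis: for every `m ≥ 2`,
`(2^{-(2^{m-1}-2)} - 2^{-(2^m-2)}) - 2·(A m - A (m-1)) ≥ 0`. -/
theorem deltaP_sub_deltaAlpha_nonneg :
    ∀ m : ℕ, 2 ≤ m →
      0 ≤ ((1 / 2 : ℝ) ^ (2 ^ (m - 1) - 2) - (1 / 2 : ℝ) ^ (2 ^ m - 2))
            - 2 * (A m - A (m - 1)) := by
  intro m hm
  obtain ⟨n, rfl⟩ := Nat.exists_eq_add_of_le' hm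
  have hR := one_sub_eta_sub_sum_le (n + 2)
  have hx : (1 / 2 : ℝ) ^ 2 ^ (n + 2 + 1) ≤ (1 / 2 : ℝ) ^ 2 ^ (n + 2) :=
    pow_le_pow_of_le_one (by norm_num) (by norm_num)
      (Nat.pow_le_pow_right (by norm_num) (by omega))
  have hp : (2 : ℝ) ^ n * (1 / 2) ^ n = 1 := by rw [← mul_pow]; norm_num
  rw [show n + 2 - 1 = n + 1 from rfl, half_pow_two_pow_sub_two (by omega),
    half_pow_two_pow_sub_two (by omega), A_succ (n + 1), A_succ n]
  rw [pow_add _ (2 ^ (n + 2 + 1)) (n + 2)] at hR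
  rw [show n + 1 + 1 = n + 2 from rfl]
  rw [sum_range_succ _ (n + 1), pow_add _ (2 ^ (n + 1 + 1)) (n + 1)] at hR ⊢
  rw [show n + 1 + 1 = n + 2 from rfl] at hR ⊢
  generalize (1 / 2 : ℝ) ^ 2 ^ (n + 2 + 1) = z at *
  generalize (1 / 2 : ℝ) ^ 2 ^ (n + 2) = y at *
  generalize ∑ i ∈ range (n + 1), (1 / 2 : ℝ) ^ (2 ^ (i + 1) + i) = s at *
  have h := mul_le_mul_of_nonneg_left hR (by positivity : (0 : ℝ) ≤ 2 ^ n)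
  simp only [pow_succ] at h ⊢
  linear_combination 4 * h + 2 * hx + (2 * z - 2 * y) * hp
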